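/- There exists an absolute constant c > 0 such that the following holds. Let q ≡ 3 (mod 4) be a prime power and let A be a multiplicative subgroup of F_q^* with |A| ≥ q^{2/3}. For any 0 < δ ≤ 1 there exists an integer q₀ = q₀(δ) with the following property: if q ≥ q₀, then any set S ⊂ F_q² with |S| ≥ δ·q² contains at least c·|S|⁴·|A|²/q⁵ quadruples (x, z, y, t) ∈ S⁴ forming a rectangle with both side-lengths in A. -/

import Mathlib

/-- The standard dot product on `F²`. -/
def dot2 {F : Type} [Field F] (u v : F × F) : F := u.1 * v.1 + u.2 * v.2

/-- Four points `x, z, y, t` of `F²` form a rectangle in this cyclic order. -/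
def IsRect {F : Type} [Field F] (x z y t : F × F) : Prop :=
  dot2 (x - z) (y - z) = 0 ∧ dot2 (z - y) (t - y) = 0 ∧
    dot2 (y - t) (x - t) = 0 ∧ dot2 (t - x) (z - x) = 0

open Finset

/-- Along a nonconstant affine parametrisation of `F`, a sum over `F` is unchanged. -/
theorem sum_comp_add_mul {F : Type} [Field F] [Fintype F] (g : F → ℝ) (y k : F) (hk : k ≠ 0) :
    ∑ b, g (y + k * b) = ∑ v, g v :=
  Equiv.sum_comp ((Equiv.mulLeft₀ k hk).trans (Equiv.addLeft y)) g

theorem sum_comp_add_right {F : Type} [Field F] [Fintype F] (g : F → ℝ) (k : F) :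
    ∑ y, g (y + k) = ∑ v, g v :=
  Equiv.sum_comp (Equiv.addRight k) g

theorem sum_mul_shift {F : Type} [Field F] [Fintype F] (g : F → ℝ) (hg : ∀ v, g v * g v = g v)
    [DecidableEq F] (l m : F) :
    ∑ b, ∑ y, g (y + l * b) * g (y + m * b) ≤
      (∑ v, g v) ^ 2 + if l = m then Fintype.card F * ∑ v, g v else 0 := by
  split_ifs with h
  · subst h
    simp only [hg]
    have : ∀ b, ∑ y, g (y + l * b) = ∑ v, g v := fun b => sum_comp_add_right g _
    simp only [this, sum_const, card_univ, nsmul_eq_mul]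
    nlinarith [sq_nonneg (∑ v, g v)]
  · have h1 : ∀ b, ∑ y, g (y + l * b) * g (y + m * b) = ∑ y, g y * g (y + (m - l) * b) := by
      intro b
      rw [← sum_comp_add_right (fun y => g y * g (y + (m - l) * b)) (l * b)]
      refine sum_congr rfl fun y _ => ?_
      congr 2
      ring
    simp only [h1]
    rw [sum_comm]
    simp only [← mul_sum, sum_comp_add_mul g _ (m - l) (sub_ne_zero.2 (Ne.symm h)), ← sum_mul]
    nlinarith

/-- Variance bound for the number of `B`-neighbours in a set with indicator function `g`. -/
theorem sum_sq_neighbours_sub_le {F : Type} [Field F] [Fintype F] (B : Subgroup Fˣ) [Fintype B]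
    (g : F → ℝ) (hg : ∀ v, g v * g v = g v) :
    ∑ y, ((∑ l : B, g (y + ((l : Fˣ) : F))) -
        Fintype.card B * (∑ v, g v) / Fintype.card F) ^ 2 ≤
      Fintype.card F * ∑ v, g v := by
  classical
  set G := ∑ v, g v with hG
  set k : ℝ := (Fintype.card B : ℝ) with hk
  set q : ℝ := (Fintype.card F : ℝ) with hq
  have hq0 : 0 < q := by rw [hq]; exact_mod_cast Fintype.card_pos
  have hk0 : 0 < k := by rw [hk]; exact_mod_cast Fintype.card_pos
  let n : F → F → ℝ := fun b y => ∑ l : B, g (y + ((l : Fˣ) : F) * b)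
  have h1 : ∑ b, ∑ y, n b y = k * q * G := by
    have : ∀ b, ∑ y, n b y = k * G := by
      intro b
      simp only [n]
      rw [sum_comm]
      simp [sum_comp_add_right g, hk, hG]
    simp [this, hq, mul_assoc, mul_left_comm]
  have h2 : ∑ b, ∑ y, n b y ^ 2 ≤ k ^ 2 * G ^ 2 + k * q * G := by
    have : ∑ b, ∑ y, n b y ^ 2 =
        ∑ l : B, ∑ m : B, ∑ b, ∑ y, g (y + ((l : Fˣ) : F) * b) * g (y + ((m : Fˣ) : F) * b) := by
      simp only [n, sq, sum_mul_sum]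
      simp_rw [sum_comm (s := (univ : Finset F)) (t := (univ : Finset B))]
    rw [this]
    calc _ ≤ ∑ l : B, ∑ m : B, (G ^ 2 + if l = m then q * G else 0) := by
          refine sum_le_sum fun l _ => sum_le_sum fun m _ => ?_
          have := sum_mul_shift g hg ((l : Fˣ) : F) ((m : Fˣ) : F)
          simpa only [Units.val_inj, Subtype.coe_inj] using this
      _ = _ := by
          simp only [sum_add_distrib, sum_const, card_univ, nsmul_eq_mul, sum_ite_eq, mem_univ,
            if_true]
          ring
  have h3 : ∑ b, ∑ y, (n b y - k * G / q) ^ 2 ≤ k * q * G := by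
    have : ∑ b, ∑ y, (n b y - k * G / q) ^ 2 =
        ∑ b, ∑ y, n b y ^ 2 - 2 * (k * G / q) * ∑ b, ∑ y, n b y + q * q * (k * G / q) ^ 2 := by
      simp only [sub_sq, sum_add_distrib, sum_sub_distrib, sum_const, card_univ, nsmul_eq_mul,
        mul_sum]
      rw [← hq]
      have : ∀ b y, 2 * n b y * (k * G / q) = 2 * (k * G / q) * n b y := fun b y => by ring
      simp only [this]
      ring
    rw [this, h1]
    have e : 2 * (k * G / q) * (k * q * G) = 2 * (k ^ 2 * G ^ 2) := by field_simp
    have e' : q * q * (k * G / q) ^ 2 = k ^ 2 * G ^ 2 := by field_simp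
    rw [e, e']
    linarith
  have h4 : ∀ b : B, ∑ y, (n ((b : Fˣ) : F) y - k * G / q) ^ 2 =
      ∑ y, (n 1 y - k * G / q) ^ 2 := by
    intro b
    refine sum_congr rfl fun y _ => ?_
    congr 2
    simp only [n, mul_one]
    rw [← Equiv.sum_comp (Equiv.mulRight b) (fun l : B => g (y + ((l : Fˣ) : F)))]
    simp
  have h5 : k * ∑ y, (n 1 y - k * G / q) ^ 2 ≤ k * q * G := by
    refine le_trans ?_ h3
    calc _ = ∑ b : B, ∑ y, (n ((b : Fˣ) : F) y - k * G / q) ^ 2 := by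
          rw [sum_congr rfl fun b _ => h4 b, sum_const, card_univ, nsmul_eq_mul]
      _ = ∑ b ∈ univ.map ⟨fun b : B => ((b : Fˣ) : F),
            fun a b h => Subtype.ext (Units.ext h)⟩, ∑ y, (n b y - k * G / q) ^ 2 := by
          rw [sum_map]; rfl
      _ ≤ _ := sum_le_sum_of_subset_of_nonneg (subset_univ _)
          fun b _ _ => sum_nonneg fun y _ => sq_nonneg _
  have h6 : ∑ y, (n 1 y - k * G / q) ^ 2 ≤ q * G :=
    le_of_mul_le_mul_left (by linarith) hk0
  simpa only [n, mul_one] using h6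

/-- Expander mixing lower bound for the Cayley graph of a multiplicative subgroup of `F`. -/
theorem edge_count_ge {F : Type} [Field F] [Fintype F] (B : Subgroup Fˣ) [Fintype B]
    (g : F → ℝ) (hg : ∀ v, g v * g v = g v) :
    Fintype.card B / Fintype.card F * (∑ v, g v) ^ 2 - √(Fintype.card F) * ∑ v, g v ≤
      ∑ y, ∑ l : B, g y * g (y + ((l : Fˣ) : F)) := by
  have hv := sum_sq_neighbours_sub_le B g hg
  have hG0 : 0 ≤ ∑ v, g v := sum_nonneg fun v _ => by rw [← hg]; exact mul_self_nonneg _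
  simp only [← mul_sum]
  set G := ∑ v, g v with hG
  set k : ℝ := (Fintype.card B : ℝ) with hk
  set q : ℝ := (Fintype.card F : ℝ) with hq
  have hcs := sum_mul_sq_le_sq_mul_sq univ g
    (fun y => (∑ l : B, g (y + ((l : Fˣ) : F))) - k * G / q)
  have e1 : ∑ y, g y ^ 2 = G := by simp only [sq, hg, hG]
  have e2 : ∑ y, g y * ((∑ l : B, g (y + ((l : Fˣ) : F))) - k * G / q) =
      ∑ y, g y * (∑ l : B, g (y + ((l : Fˣ) : F))) - k / q * G ^ 2 := by
    simp only [mul_sub, sum_sub_distrib, ← sum_mul]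
    rw [← hG]; ring
  rw [e1, e2] at hcs
  have h : (∑ y, g y * (∑ l : B, g (y + ((l : Fˣ) : F))) - k / q * G ^ 2) ^ 2 ≤
      (√q * G) ^ 2 := by
    rw [mul_pow, Real.sq_sqrt (by rw [hq]; positivity)]
    calc _ ≤ _ := hcs
      _ ≤ G * (q * G) := mul_le_mul_of_nonneg_left hv hG0
      _ = _ := by ring
  have := (abs_le_of_sq_le_sq' h (by positivity)).1
  linarith

/-- Lower bound for the number of axis-parallel rectangles with both side vectors in `B`. -/
theorem grid_rect_ge {F : Type} [Field F] [Fintype F] (B : Subgroup Fˣ) [Fintype B]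
    (f : F → F → ℝ) (hf : ∀ u v, f u v * f u v = f u v)
    (h1 : 2 * (Fintype.card F : ℝ) ^ 2 * √(Fintype.card F) ≤ Fintype.card B * ∑ u, ∑ v, f u v)
    (h2 : 4 * (Fintype.card F : ℝ) ^ 4 * √(Fintype.card F) ≤
      Fintype.card B * (∑ u, ∑ v, f u v) ^ 2) :
    (Fintype.card B : ℝ) ^ 2 * (∑ u, ∑ v, f u v) ^ 4 / (8 * (Fintype.card F : ℝ) ^ 6) ≤
      ∑ u, ∑ a : B, ∑ v, ∑ b : B, (f u v * f (u + ((a : Fˣ) : F)) v) *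
        (f u (v + ((b : Fˣ) : F)) * f (u + ((a : Fˣ) : F)) (v + ((b : Fˣ) : F))) := by
  have hf0 : ∀ u v, 0 ≤ f u v := fun u v => by rw [← hf]; exact mul_self_nonneg _
  set T := ∑ u, ∑ a : B, ∑ v, f u v * f (u + ((a : Fˣ) : F)) v with hT
  set s := ∑ u, ∑ v, f u v with hs
  set k : ℝ := (Fintype.card B : ℝ) with hk
  set q : ℝ := (Fintype.card F : ℝ) with hq
  have hq0 : 0 < q := by rw [hq]; exact_mod_cast Fintype.card_pos
  have hk0 : 0 < k := by rw [hk]; exact_mod_cast Fintype.card_pos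
  have hs0 : 0 ≤ s := sum_nonneg fun u _ => sum_nonneg fun v _ => hf0 u v
  have hTlow : k / q ^ 2 * s ^ 2 - √q * s ≤ T := by
    have e : T = ∑ v, ∑ u, ∑ a : B, f u v * f (u + ((a : Fˣ) : F)) v :=
      (sum_congr rfl fun u _ => sum_comm).trans sum_comm
    have e' : s = ∑ v, ∑ u, f u v := sum_comm
    have hc : s ^ 2 ≤ q * ∑ v, (∑ u, f u v) ^ 2 := by
      rw [e']
      have := sq_sum_le_card_mul_sum_sq (s := (univ : Finset F)) (f := fun v => ∑ u, f u v)
      simpa [hq] using this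
    calc k / q ^ 2 * s ^ 2 - √q * s ≤ k / q ^ 2 * (q * ∑ v, (∑ u, f u v) ^ 2) - √q * s := by
          gcongr
      _ = ∑ v, (k / q * (∑ u, f u v) ^ 2 - √q * ∑ u, f u v) := by
          rw [sum_sub_distrib, ← mul_sum, ← mul_sum, ← e']
          field_simp
      _ ≤ T := by
          rw [e]
          exact sum_le_sum fun v _ => edge_count_ge B (fun u => f u v) fun u => hf u v
  have hR : T ^ 2 / q ^ 2 - √q * T ≤
      ∑ u, ∑ a : B, ∑ v, ∑ b : B, (f u v * f (u + ((a : Fˣ) : F)) v) *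
        (f u (v + ((b : Fˣ) : F)) * f (u + ((a : Fˣ) : F)) (v + ((b : Fˣ) : F))) := by
    have hc : T ^ 2 ≤ (q * k) *
        ∑ u, ∑ a : B, (∑ v, f u v * f (u + ((a : Fˣ) : F)) v) ^ 2 := by
      have := sq_sum_le_card_mul_sum_sq (s := (univ : Finset (F × B)))
        (f := fun p => ∑ v, f p.1 v * f (p.1 + ((p.2 : Fˣ) : F)) v)
      rw [Fintype.sum_prod_type, Fintype.sum_prod_type] at this
      simpa [hq, hk] using this
    calc T ^ 2 / q ^ 2 - √q * T ≤ ((q * k) *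
        ∑ u, ∑ a : B, (∑ v, f u v * f (u + ((a : Fˣ) : F)) v) ^ 2) / q ^ 2 - √q * T := by
          gcongr
      _ = ∑ u, ∑ a : B, (k / q * (∑ v, f u v * f (u + ((a : Fˣ) : F)) v) ^ 2 -
            √q * ∑ v, f u v * f (u + ((a : Fˣ) : F)) v) := by
          simp only [sum_sub_distrib, ← mul_sum]
          rw [← hT]
          field_simp
      _ ≤ _ := by
          refine sum_le_sum fun u _ => sum_le_sum fun a _ => ?_
          refine edge_count_ge B (fun v => f u v * f (u + ((a : Fˣ) : F)) v) fun v => ?_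
          rw [mul_mul_mul_comm, hf, hf]
  refine le_trans ?_ hR
  have t1 : k * s ^ 2 / (2 * q ^ 2) ≤ T := by
    refine le_trans ?_ hTlow
    have : √q * s ≤ k * s ^ 2 / (2 * q ^ 2) := by
      rw [le_div_iff₀ (by positivity)]
      nlinarith [mul_le_mul_of_nonneg_right h1 hs0]
    have e : k / q ^ 2 * s ^ 2 = 2 * (k * s ^ 2 / (2 * q ^ 2)) := by field_simp
    linarith
  have t2 : 2 * q ^ 2 * √q ≤ T := by
    refine le_trans ?_ t1
    rw [le_div_iff₀ (by positivity)]
    linarith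
  have hT0 : 0 ≤ T := le_trans (by positivity) t2
  have t3 : √q * T ≤ T ^ 2 / (2 * q ^ 2) := by
    rw [le_div_iff₀ (by positivity)]
    nlinarith [mul_le_mul_of_nonneg_right t2 hT0]
  have t4 : (k * s ^ 2 / (2 * q ^ 2)) ^ 2 ≤ T ^ 2 := by gcongr
  have e1 : k ^ 2 * s ^ 4 / (8 * q ^ 6) = (k * s ^ 2 / (2 * q ^ 2)) ^ 2 / (2 * q ^ 2) := by
    field_simp; norm_num
  have e2 : T ^ 2 / q ^ 2 = 2 * (T ^ 2 / (2 * q ^ 2)) := by field_simp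
  have t5 : (k * s ^ 2 / (2 * q ^ 2)) ^ 2 / (2 * q ^ 2) ≤ T ^ 2 / (2 * q ^ 2) := by gcongr
  rw [e1, e2]
  linarith

theorem eq_zero_of_dot2_self {F : Type} [Field F] [Fintype F] (hF : Fintype.card F % 4 = 3)
    (w : F × F) (h : dot2 w w = 0) : w = 0 := by
  have hns : ¬ IsSquare (-1 : F) := fun h => FiniteField.isSquare_neg_one_iff.1 h hF
  unfold dot2 at h
  have h2 : w.2 = 0 := by
    by_contra h2
    refine hns ⟨w.1 / w.2, ?_⟩
    field_simp
    linear_combination -h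
  have h1 : w.1 = 0 := by simpa [h2] using h
  exact Prod.ext h1 h2

/-- The point with coordinates `p` in the orthogonal frame `w, iw`; this is the product of `w` and
`p` in `F(i)`. -/
def framePoint {F : Type} [Field F] (w p : F × F) : F × F :=
  (p.1 * w.1 - p.2 * w.2, p.1 * w.2 + p.2 * w.1)

theorem dot2_framePoint {F : Type} [Field F] (w p : F × F) :
    dot2 (framePoint w p) (framePoint w p) = dot2 w w * dot2 p p := by
  simp only [dot2, framePoint]; ring

theorem framePoint_injective {F : Type} [Field F] (w : F × F) (hw : dot2 w w ≠ 0) :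
    Function.Injective (framePoint w) := by
  intro p r h
  simp only [framePoint, Prod.mk.injEq] at h
  obtain ⟨h1, h2⟩ := h
  simp only [dot2] at hw
  ext <;> refine mul_right_cancel₀ hw ?_
  · linear_combination w.1 * h1 + w.2 * h2
  · linear_combination w.1 * h2 - w.2 * h1

theorem exists_dot2_self_eq {F : Type} [Field F] [Fintype F] (hF : Fintype.card F % 4 = 3)
    (n : F) : ∃ k : F × F, dot2 k k = n := by
  obtain ⟨a, b, h⟩ := FiniteField.exists_root_sum_quadratic
    (f := (Polynomial.X ^ 2 : Polynomial F)) (g := Polynomial.X ^ 2 - Polynomial.C n)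
    (by simp) (by compute_degree!) (by omega)
  refine ⟨(a, b), ?_⟩
  simp only [Polynomial.eval_pow, Polynomial.eval_X, Polynomial.eval_sub, Polynomial.eval_C] at h
  simp only [dot2]
  linear_combination h

theorem card_le_card_dot2_self_eq {F : Type} [Field F] [Fintype F] [DecidableEq F]
    (hF : Fintype.card F % 4 = 3) (n : F) (hn : n ≠ 0) :
    Fintype.card F ≤ #{w : F × F | dot2 w w = n} := by
  set r : F → ℕ := fun n => #{w : F × F | dot2 w w = n} with hr
  have hle : ∀ m, m ≠ 0 → r m ≤ r n := by
    intro m hm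
    obtain ⟨k, hk⟩ := exists_dot2_self_eq hF (n / m)
    refine card_le_card_of_injOn (framePoint k) ?_
      (framePoint_injective k (by rw [hk]; exact div_ne_zero hn hm)).injOn
    intro w hw
    simp only [coe_filter, mem_univ, true_and, Set.mem_ofPred_eq] at hw ⊢
    rw [dot2_framePoint, hk, hw, div_mul_cancel₀ _ hm]
  have h0 : r 0 ≤ 1 := by
    refine card_le_one.2 fun a ha b hb => ?_
    simp only [mem_filter, mem_univ, true_and] at ha hb
    rw [eq_zero_of_dot2_self hF a ha, eq_zero_of_dot2_self hF b hb]
  have hsum : Fintype.card F * Fintype.card F = ∑ m, r m := by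
    rw [← Fintype.card_prod, ← card_univ]
    exact card_eq_sum_card_fiberwise (f := fun w : F × F => dot2 w w) (t := univ) (by simp)
  have hbound : ∑ m, r m ≤ 1 + (Fintype.card F - 1) * r n := by
    rw [← add_sum_erase univ r (mem_univ 0)]
    refine add_le_add h0 ?_
    calc ∑ m ∈ univ.erase 0, r m ≤ #((univ : Finset F).erase 0) • r n :=
          sum_le_card_nsmul _ _ _ fun m hm => hle m (ne_of_mem_erase hm)
      _ = _ := by simp [card_erase_of_mem]
  change Fintype.card F ≤ r n
  obtain ⟨p, hp⟩ : ∃ p, Fintype.card F = p + 1 := ⟨Fintype.card F - 1, by omega⟩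
  have hp1 : 1 ≤ p := by omega
  rw [← hsum, hp, Nat.add_sub_cancel] at hbound
  rw [hp]
  by_contra! hlt
  have := Nat.mul_le_mul_left p (Nat.le_of_lt_succ hlt)
  nlinarith

theorem card_mul_card_le_card_dot2_self_mem {F : Type} [Field F] [Fintype F] [DecidableEq F]
    (hF : Fintype.card F % 4 = 3) (A : Subgroup Fˣ) [Fintype A]
    [DecidablePred fun w : F × F => ∃ u ∈ A, (u : F) = dot2 w w] :
    Fintype.card A * Fintype.card F ≤ #{w : F × F | ∃ u ∈ A, (u : F) = dot2 w w} := by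
  let t : Finset F := univ.map ⟨fun b : A => ((b : Fˣ) : F), fun a b h => Subtype.ext (Units.ext h)⟩
  have ht : #t = Fintype.card A := by simp [t]
  rw [card_eq_sum_card_fiberwise (f := fun w : F × F => dot2 w w) (t := t)]
  · rw [← ht, ← smul_eq_mul]
    refine card_nsmul_le_sum _ _ _ fun n hn => ?_
    obtain ⟨a, -, rfl⟩ := mem_map.1 hn
    refine (card_le_card_dot2_self_eq hF _ (Units.ne_zero (a : Fˣ))).trans (card_le_card ?_)
    intro w hw
    simp only [mem_filter, mem_univ, true_and] at hw ⊢
    exact ⟨⟨a, a.2, hw.symm⟩, hw⟩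
  · intro w hw
    simp only [coe_filter, mem_univ, true_and, Set.mem_ofPred_eq] at hw
    obtain ⟨u, hu, huw⟩ := hw
    simp only [t, coe_map, Set.mem_image, mem_coe, mem_univ, true_and]
    exact ⟨⟨u, hu⟩, huw⟩

/-- The quadruples of points of `S` forming a rectangle with both side-lengths in `A`. -/
def rectSet {F : Type} [Field F] (A : Subgroup Fˣ) (S : Set (F × F)) :
    Set ((F × F) × (F × F) × (F × F) × (F × F)) :=
  {p | p.1 ∈ S ∧ p.2.1 ∈ S ∧ p.2.2.1 ∈ S ∧ p.2.2.2 ∈ S ∧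
    IsRect p.1 p.2.1 p.2.2.1 p.2.2.2 ∧
    (∃ u ∈ A, (u : F) = dot2 (p.1 - p.2.1) (p.1 - p.2.1)) ∧
    (∃ u ∈ A, (u : F) = dot2 (p.2.1 - p.2.2.1) (p.2.1 - p.2.2.1))}

/-- The rectangle with corner `(u, v)` and side vectors `a w`, `b iw` in the frame `w, iw`. -/
def frameRect {F : Type} [Field F] (w : F × F) (u a v b : F) :
    (F × F) × (F × F) × (F × F) × (F × F) :=
  (framePoint w (u + a, v), framePoint w (u, v), framePoint w (u, v + b),
    framePoint w (u + a, v + b))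

theorem isRect_frameRect {F : Type} [Field F] (w : F × F) (u a v b : F) :
    IsRect (frameRect w u a v b).1 (frameRect w u a v b).2.1 (frameRect w u a v b).2.2.1
      (frameRect w u a v b).2.2.2 := by
  simp only [IsRect, frameRect, framePoint, dot2, Prod.fst_sub, Prod.snd_sub]
  refine ⟨?_, ?_, ?_, ?_⟩ <;> ring

theorem frameRect_mem_rectSet {F : Type} [Field F] (A : Subgroup Fˣ) (S : Set (F × F))
    (w : F × F) (hw : ∃ u ∈ A, (u : F) = dot2 w w) (u v : F) (a b : Fˣ)
    (ha : a ^ 2 ∈ A) (hb : b ^ 2 ∈ A)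
    (h1 : framePoint w (u, v) ∈ S) (h2 : framePoint w (u + a, v) ∈ S)
    (h3 : framePoint w (u, v + b) ∈ S) (h4 : framePoint w (u + a, v + b) ∈ S) :
    frameRect w u a v b ∈ rectSet A S := by
  obtain ⟨n, hn, hnw⟩ := hw
  refine ⟨h2, h1, h3, h4, isRect_frameRect w u a v b, ⟨n * a ^ 2, A.mul_mem hn ha, ?_⟩,
    ⟨n * b ^ 2, A.mul_mem hn hb, ?_⟩⟩
  all_goals
    simp only [Units.val_mul, Units.val_pow_eq_pow_val, hnw, frameRect, framePoint, dot2,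
      Prod.fst_sub, Prod.snd_sub]
    ring

/-- A rectangle and one of its side parameters determine the frame and all other parameters. -/
theorem frameRect_inj {F : Type} [Field F] {w w' : F × F} (hw : dot2 w w ≠ 0)
    {u a v b u' v' b' : F} (ha : a ≠ 0) (h : frameRect w u a v b = frameRect w' u' a v' b') :
    w = w' ∧ u = u' ∧ v = v' ∧ b = b' := by
  simp only [frameRect, Prod.mk.injEq] at h
  obtain ⟨h1, h2, h3, -⟩ := h
  have hww : w = w' := by
    simp only [framePoint, Prod.mk.injEq] at h1 h2
    ext <;> refine mul_left_cancel₀ ha ?_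
    · linear_combination h1.1 - h2.1
    · linear_combination h1.2 - h2.2
  subst hww
  have e1 := framePoint_injective w hw h2
  have e2 := framePoint_injective w hw h3
  simp only [Prod.mk.injEq] at e1 e2
  obtain ⟨rfl, rfl⟩ := e1
  exact ⟨rfl, rfl, rfl, add_left_cancel e2.2⟩

theorem sum_frame_indicator {F : Type} [Field F] [Fintype F] (S : Set (F × F))
    [DecidablePred (· ∈ S)] (w : F × F) (hw : dot2 w w ≠ 0) :
    ∑ u, ∑ v, (if framePoint w (u, v) ∈ S then (1 : ℝ) else 0) = S.ncard := by
  rw [← Fintype.sum_prod_type' (f := fun u v => if framePoint w (u, v) ∈ S then (1 : ℝ) else 0)]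
  rw [Function.Bijective.sum_comp (Finite.injective_iff_bijective.1 (framePoint_injective w hw))
    (fun p => if p ∈ S then (1 : ℝ) else 0)]
  rw [sum_boole, Set.ncard_eq_toFinset_card']
  congr 2
  ext p
  simp

theorem sum_frame_rect_le {F : Type} [Field F] [Fintype F] (A B : Subgroup Fˣ)
    [Fintype B] (hB : ∀ b ∈ B, b ^ 2 ∈ A) (S : Set (F × F)) [DecidablePred (· ∈ S)]
    [DecidablePred fun w : F × F => ∃ u ∈ A, (u : F) = dot2 w w]
    (f : F × F → F → F → ℝ) (hf : ∀ w u v, f w u v = if framePoint w (u, v) ∈ S then 1 else 0) :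
    ∑ w with ∃ u ∈ A, (u : F) = dot2 w w, ∑ u, ∑ a : B, ∑ v, ∑ b : B,
        (f w u v * f w (u + ((a : Fˣ) : F)) v) *
        (f w u (v + ((b : Fˣ) : F)) * f w (u + ((a : Fˣ) : F)) (v + ((b : Fˣ) : F))) ≤
      (rectSet A S).ncard * Fintype.card B := by
  classical
  let D : Finset ((F × F) × F × B × F × B) :=
    (({w : F × F | ∃ u ∈ A, (u : F) = dot2 w w} : Finset (F × F)) ×ˢ univ).filter fun x =>
      (framePoint x.1 (x.2.1, x.2.2.2.1) ∈ S ∧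
        framePoint x.1 (x.2.1 + ((x.2.2.1 : Fˣ) : F), x.2.2.2.1) ∈ S) ∧
      (framePoint x.1 (x.2.1, x.2.2.2.1 + ((x.2.2.2.2 : Fˣ) : F)) ∈ S ∧
        framePoint x.1 (x.2.1 + ((x.2.2.1 : Fˣ) : F), x.2.2.2.1 + ((x.2.2.2.2 : Fˣ) : F)) ∈ S)
  have hD : (#D : ℝ) = ∑ w with ∃ u ∈ A, (u : F) = dot2 w w, ∑ u, ∑ a : B, ∑ v, ∑ b : B,
        (f w u v * f w (u + ((a : Fˣ) : F)) v) *
        (f w u (v + ((b : Fˣ) : F)) * f w (u + ((a : Fˣ) : F)) (v + ((b : Fˣ) : F))) := by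
    rw [card_filter, sum_product, Nat.cast_sum]
    refine sum_congr rfl fun w _ => ?_
    simp only [Fintype.sum_prod_type, Nat.cast_sum, hf, ite_zero_mul_ite_zero, mul_one,
      Nat.cast_ite, Nat.cast_one, Nat.cast_zero]
  rw [← hD, Set.ncard_eq_toFinset_card', ← card_univ, ← Nat.cast_mul, ← card_product]
  refine Nat.cast_le.2 (card_le_card_of_injOn
    (fun x => (frameRect x.1 x.2.1 ((x.2.2.1 : Fˣ) : F) x.2.2.2.1 ((x.2.2.2.2 : Fˣ) : F),
      x.2.2.1)) ?_ ?_)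
  · rintro ⟨w, u, a, v, b⟩ hx
    simp only [D, coe_filter, mem_product, mem_filter, mem_univ, true_and, and_true,
      Set.mem_ofPred_eq] at hx
    obtain ⟨hw, ⟨h1, h2⟩, h3, h4⟩ := hx
    simp only [coe_product, Set.coe_toFinset, coe_univ, Set.mem_prod, Set.mem_univ, and_true]
    exact frameRect_mem_rectSet A S w hw u v a b (hB _ a.2) (hB _ b.2) h1 h2 h3 h4
  · rintro ⟨w, u, a, v, b⟩ hx ⟨w', u', a', v', b'⟩ - h
    simp only [D, coe_filter, mem_product, mem_filter, mem_univ, true_and, and_true,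
      Set.mem_ofPred_eq] at hx
    obtain ⟨⟨n, -, hn⟩, -⟩ := hx
    simp only [Prod.mk.injEq] at h
    obtain ⟨h, rfl⟩ := h
    obtain ⟨rfl, rfl, rfl, hb⟩ :=
      frameRect_inj (hn ▸ Units.ne_zero n) (Units.ne_zero (a : Fˣ)) h
    rw [Subtype.ext (Units.ext hb)]

theorem card_le_card_comap_sq {G : Type} [CommGroup G] [Finite G] (A : Subgroup G) :
    Nat.card A ≤ Nat.card (A.comap (powMonoidHom 2)) :=
  Subgroup.card_le_of_le fun _ ha => A.pow_mem ha 2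

theorem rectSet_ncard_ge {F : Type} [Field F] [Fintype F] (hF : Fintype.card F % 4 = 3)
    (A : Subgroup Fˣ) (S : Set (F × F))
    (h1 : 2 * (Fintype.card F : ℝ) ^ 2 * √(Fintype.card F) ≤ Nat.card A * S.ncard)
    (h2 : 4 * (Fintype.card F : ℝ) ^ 4 * √(Fintype.card F) ≤ Nat.card A * (S.ncard : ℝ) ^ 2) :
    (S.ncard : ℝ) ^ 4 * (Nat.card A : ℝ) ^ 2 / (8 * (Fintype.card F : ℝ) ^ 5) ≤
      (rectSet A S).ncard := by
  classical
  set B := A.comap (powMonoidHom 2)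
  have hAB : (Nat.card A : ℝ) ≤ Fintype.card B := by
    rw [← Nat.card_eq_fintype_card]
    exact_mod_cast card_le_card_comap_sq A
  let f : F × F → F → F → ℝ := fun w u v => if framePoint w (u, v) ∈ S then 1 else 0
  have hsum := sum_frame_rect_le A B (fun b hb => hb) S f fun _ _ _ => rfl
  have hcount : (Nat.card A * Fintype.card F : ℝ) ≤
      #{w : F × F | ∃ u ∈ A, (u : F) = dot2 w w} := by
    rw [Nat.card_eq_fintype_card]
    exact_mod_cast card_mul_card_le_card_dot2_self_mem hF A
  set q : ℝ := (Fintype.card F : ℝ) with hq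
  set k : ℝ := (Fintype.card B : ℝ) with hk
  set s : ℝ := (S.ncard : ℝ) with hs
  set α : ℝ := (Nat.card A : ℝ) with hα
  have hq0 : 0 < q := by rw [hq]; exact_mod_cast Fintype.card_pos
  have hk0 : 0 < k := by rw [hk]; exact_mod_cast Fintype.card_pos
  have hs0 : 0 ≤ s := by positivity
  have hα0 : 0 ≤ α := by positivity
  have hgrid := card_nsmul_le_sum {w : F × F | ∃ u ∈ A, (u : F) = dot2 w w}
    (fun w => ∑ u, ∑ a : B, ∑ v, ∑ b : B, (f w u v * f w (u + ((a : Fˣ) : F)) v) *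
        (f w u (v + ((b : Fˣ) : F)) * f w (u + ((a : Fˣ) : F)) (v + ((b : Fˣ) : F))))
    (k ^ 2 * s ^ 4 / (8 * q ^ 6)) fun w hw => by
      obtain ⟨n, -, hn⟩ := (mem_filter.1 hw).2
      have hsw : ∑ u, ∑ v, f w u v = s := sum_frame_indicator S w (hn ▸ Units.ne_zero n)
      have := grid_rect_ge B (f w) (fun u v => by simp only [f]; split_ifs <;> simp)
        (by rw [hsw]; exact h1.trans (by gcongr)) (by rw [hsw]; exact h2.trans (by gcongr))
      rwa [hsw] at this
  rw [nsmul_eq_mul] at hgrid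
  have h := (mul_le_mul_of_nonneg_right hcount (by positivity)).trans (hgrid.trans hsum)
  refine le_of_mul_le_mul_right (le_trans ?_ h) hk0
  calc s ^ 4 * α ^ 2 / (8 * q ^ 5) * k = (s ^ 4 * k / (8 * q ^ 5)) * α * α := by ring
    _ ≤ (s ^ 4 * k / (8 * q ^ 5)) * α * k := by gcongr
    _ = α * q * (k ^ 2 * s ^ 4 / (8 * q ^ 6)) := by field_simp

theorem sqrt_le_rpow_two_thirds {δ q : ℝ} (hδ : 0 < δ) (hq : (4 / δ ^ 2) ^ 6 ≤ q) :
    4 * √q ≤ δ ^ 2 * q ^ ((2 : ℝ) / 3) := by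
  have hq0 : 0 < q := lt_of_lt_of_le (by positivity) hq
  have h : 4 / δ ^ 2 ≤ q ^ ((1 : ℝ) / 6) := by
    have := Real.rpow_le_rpow (by positivity) hq (show (0 : ℝ) ≤ 1 / 6 by norm_num)
    rwa [← Real.rpow_natCast, ← Real.rpow_mul (by positivity),
      show ((6 : ℕ) : ℝ) * (1 / 6) = 1 by norm_num, Real.rpow_one] at this
  have e : q ^ ((2 : ℝ) / 3) = √q * q ^ ((1 : ℝ) / 6) := by
    rw [Real.sqrt_eq_rpow, ← Real.rpow_add hq0]; norm_num
  rw [div_le_iff₀ (by positivity)] at h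
  rw [e]
  nlinarith [mul_le_mul_of_nonneg_left h (Real.sqrt_nonneg q)]

theorem stmt_2 :
    ∃ c : ℝ, 0 < c ∧
      ∀ δ : ℝ, 0 < δ → δ ≤ 1 →
        ∃ q₀ : ℕ,
          ∀ (F : Type) [Field F] [Fintype F],
            q₀ ≤ Fintype.card F →
            Fintype.card F % 4 = 3 →
            ∀ A : Subgroup Fˣ,
              (Fintype.card F : ℝ) ^ ((2 : ℝ) / 3) ≤ (Nat.card A : ℝ) →
              ∀ S : Set (F × F),
                δ * (Fintype.card F : ℝ) ^ 2 ≤ (S.ncard : ℝ) →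
                c * (S.ncard : ℝ) ^ 4 * (Nat.card A : ℝ) ^ 2 / (Fintype.card F : ℝ) ^ 5 ≤
                  (Set.ncard {p : (F × F) × (F × F) × (F × F) × (F × F) |
                    p.1 ∈ S ∧ p.2.1 ∈ S ∧ p.2.2.1 ∈ S ∧ p.2.2.2 ∈ S ∧
                    IsRect p.1 p.2.1 p.2.2.1 p.2.2.2 ∧
                    (∃ u ∈ A, (u : F) = dot2 (p.1 - p.2.1) (p.1 - p.2.1)) ∧
                    (∃ u ∈ A, (u : F) = dot2 (p.2.1 - p.2.2.1) (p.2.1 - p.2.2.1))} : ℝ) := by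
  refine ⟨1 / 8, by norm_num, fun δ hδ hδ1 => ⟨⌈(4 / δ ^ 2) ^ 6⌉₊, fun F _ _ hq hF A hA S hS => ?_⟩⟩
  have hs := sqrt_le_rpow_two_thirds hδ ((Nat.ceil_le.1 hq))
  have hmul : 4 * √(Fintype.card F) ≤ δ ^ 2 * (Nat.card A : ℝ) := hs.trans (by gcongr)
  have hmul' : 4 * √(Fintype.card F) ≤ δ * (Nat.card A : ℝ) := hmul.trans (by gcongr; nlinarith)
  have := rectSet_ncard_ge hF A S ?_ ?_
  · refine le_trans (le_of_eq ?_) this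
    field_simp
  · calc 2 * (Fintype.card F : ℝ) ^ 2 * √(Fintype.card F)
        ≤ (Fintype.card F : ℝ) ^ 2 * (4 * √(Fintype.card F)) := by
          nlinarith [show 0 ≤ (Fintype.card F : ℝ) ^ 2 * √(Fintype.card F) by positivity]
      _ ≤ (Fintype.card F : ℝ) ^ 2 * (δ * (Nat.card A : ℝ)) := by gcongr
      _ = Nat.card A * (δ * (Fintype.card F : ℝ) ^ 2) := by ring
      _ ≤ Nat.card A * S.ncard := by gcongr
  · calc 4 * (Fintype.card F : ℝ) ^ 4 * √(Fintype.card F)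
        = (Fintype.card F : ℝ) ^ 4 * (4 * √(Fintype.card F)) := by ring
      _ ≤ (Fintype.card F : ℝ) ^ 4 * (δ ^ 2 * (Nat.card A : ℝ)) := by gcongr
      _ = Nat.card A * (δ * (Fintype.card F : ℝ) ^ 2) ^ 2 := by ring
      _ ≤ Nat.card A * (S.ncard : ℝ) ^ 2 := by gcongr
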